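/- Let {(A_i, ∂_i)}_{i∈ℤ} be a collection of differential modules over 𝔽₂, let f_i : A_i → A_{i+1} be chain maps, and for each i let H_i : A_i → A_{i+2} be a null-homotopy of f_{i+1} ∘ f_i. Suppose that for every i the chain map ψ_i := f_{i+2} ∘ H_i + H_{i+1} ∘ f_i : A_i → A_{i+3} induces an isomorphism on homology. Then for every i the chain map (H_i, f_{i+1}) : M(f_i) → A_{i+2}, (a, b) ↦ H_i(a) + f_{i+1}(b), induces an isomorphism H(M(f_i)) → H(A_{i+2}). -/

import Mathlib

/-- The field with two elements. -/
abbrev F2 : Type := ZMod 2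

/-- The homology of a differential module `(M, d)` over `𝔽₂`: cycles modulo boundaries. -/
abbrev DiffHomology {M : Type*} [AddCommGroup M] [Module F2 M] (d : M →ₗ[F2] M) : Type _ :=
  LinearMap.ker d ⧸ (LinearMap.range d).comap (LinearMap.ker d).subtype

/-- A chain map restricts to a map on cycles. -/
def cycleMap {A B : Type*} [AddCommGroup A] [Module F2 A] [AddCommGroup B] [Module F2 B]
    (dA : A →ₗ[F2] A) (dB : B →ₗ[F2] B) (f : A →ₗ[F2] B) (hf : f ∘ₗ dA = dB ∘ₗ f) :
    LinearMap.ker dA →ₗ[F2] LinearMap.ker dB :=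
  f.restrict (fun x hx => by
    have h := LinearMap.congr_fun hf x
    simp only [LinearMap.comp_apply] at h
    simp only [LinearMap.mem_ker] at hx ⊢
    rw [← h, hx, map_zero])

/-- The map induced on homology by a chain map between differential modules over `𝔽₂`. -/
def inducedMap {A B : Type*} [AddCommGroup A] [Module F2 A] [AddCommGroup B] [Module F2 B]
    (dA : A →ₗ[F2] A) (dB : B →ₗ[F2] B) (f : A →ₗ[F2] B) (hf : f ∘ₗ dA = dB ∘ₗ f) :
    DiffHomology dA →ₗ[F2] DiffHomology dB :=
  Submodule.mapQ _ _ (cycleMap dA dB f hf) (by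
    rintro ⟨x, hx⟩ hmem
    simp only [Submodule.mem_comap, Submodule.coe_subtype, LinearMap.mem_range] at hmem ⊢
    obtain ⟨y, hy⟩ := hmem
    refine ⟨f y, ?_⟩
    have h := LinearMap.congr_fun hf y
    simp only [LinearMap.comp_apply] at h
    simp only [cycleMap, LinearMap.restrict_coe_apply]
    rw [← h, hy])

section InducedMap

variable {A B : Type*} [AddCommGroup A] [Module F2 A] [AddCommGroup B] [Module F2 B]
  {dA : A →ₗ[F2] A} {dB : B →ₗ[F2] B} {f : A →ₗ[F2] B}

theorem inducedMap_injective_iff (hf : f ∘ₗ dA = dB ∘ₗ f) :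
    Function.Injective (inducedMap dA dB f hf) ↔
      ∀ x, dA x = 0 → (∃ y, dB y = f x) → ∃ z, dA z = x := by
  rw [injective_iff_map_eq_zero]
  constructor
  · rintro h x hx ⟨y, hy⟩
    have := h (Submodule.Quotient.mk ⟨x, hx⟩)
      ((Submodule.Quotient.mk_eq_zero _).2 ⟨y, hy⟩)
    exact (Submodule.Quotient.mk_eq_zero _).1 this
  · intro h q hq
    obtain ⟨⟨x, hx⟩, rfl⟩ := Submodule.Quotient.mk_surjective _ q
    exact (Submodule.Quotient.mk_eq_zero _).2 (h x hx ((Submodule.Quotient.mk_eq_zero _).1 hq))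

theorem inducedMap_surjective_iff (hf : f ∘ₗ dA = dB ∘ₗ f) :
    Function.Surjective (inducedMap dA dB f hf) ↔
      ∀ y, dB y = 0 → ∃ x, dA x = 0 ∧ ∃ z, dB z = y + f x := by
  constructor
  · intro h y hy
    obtain ⟨q, hq⟩ := h (Submodule.Quotient.mk ⟨y, hy⟩)
    obtain ⟨⟨x, hx⟩, rfl⟩ := Submodule.Quotient.mk_surjective _ q
    obtain ⟨z, hz⟩ := (Submodule.Quotient.eq _).1 hq
    replace hz : dB z = f x - y := hz
    exact ⟨x, hx, z, by linear_combination (norm := (match_scalars <;> decide)) (1 : F2) • hz⟩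
  · intro h q
    obtain ⟨⟨y, hy⟩, rfl⟩ := Submodule.Quotient.mk_surjective _ q
    obtain ⟨x, hx, z, hz⟩ := h y hy
    refine ⟨Submodule.Quotient.mk ⟨x, hx⟩, (Submodule.Quotient.eq _).2 ⟨z, ?_⟩⟩
    change dB z = f x - y
    linear_combination (norm := (match_scalars <;> decide)) (1 : F2) • hz

end InducedMap

section TriangleDetection

variable {A₀ A₁ A₂ A₃ A₄ A₅ : Type*}
  [AddCommGroup A₀] [Module F2 A₀] [AddCommGroup A₁] [Module F2 A₁]
  [AddCommGroup A₂] [Module F2 A₂] [AddCommGroup A₃] [Module F2 A₃]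
  [AddCommGroup A₄] [Module F2 A₄] [AddCommGroup A₅] [Module F2 A₅]
  {d₀ : A₀ →ₗ[F2] A₀} {d₁ : A₁ →ₗ[F2] A₁} {d₂ : A₂ →ₗ[F2] A₂}
  {d₃ : A₃ →ₗ[F2] A₃} {d₄ : A₄ →ₗ[F2] A₄} {d₅ : A₅ →ₗ[F2] A₅}
  {f₀ : A₀ →ₗ[F2] A₁} {f₁ : A₁ →ₗ[F2] A₂} {f₂ : A₂ →ₗ[F2] A₃} {f₃ : A₃ →ₗ[F2] A₄}
  {f₄ : A₄ →ₗ[F2] A₅}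
  {h₀ : A₀ →ₗ[F2] A₂} {h₁ : A₁ →ₗ[F2] A₃} {h₂ : A₂ →ₗ[F2] A₄} {h₃ : A₃ →ₗ[F2] A₅}

/-- On cycles, `f₃ ∘ ψ₀` and `ψ₁ ∘ f₀` differ by the boundary of `h₂ ∘ h₀`. -/
theorem psi_comp_eq (hh₀ : ∀ x, f₁ (f₀ x) = d₂ (h₀ x) + h₀ (d₀ x))
    (hh₂ : ∀ x, f₃ (f₂ x) = d₄ (h₂ x) + h₂ (d₂ x)) {w : A₀} (hw : d₀ w = 0) :
    f₃ (h₁ (f₀ w)) + h₂ (f₁ (f₀ w)) = f₃ (f₂ (h₀ w) + h₁ (f₀ w)) + d₄ (h₂ (h₀ w)) := by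
  have e₁ := congrArg h₂ (hh₀ w)
  simp only [hw, map_add, map_zero] at e₁ ⊢
  linear_combination (norm := (match_scalars <;> decide)) (1 : F2) • (e₁ + hh₂ (h₀ w))

/-- A cycle `(a, b)` of the cone of `f₀` whose image `h₀ a + f₁ b` is a boundary is a boundary. -/
theorem cone_boundary_of_image_boundary
    (hf₀ : ∀ x, f₀ (d₀ x) = d₁ (f₀ x)) (hf₂ : ∀ x, f₂ (d₂ x) = d₃ (f₂ x))
    (hf₃ : ∀ x, f₃ (d₃ x) = d₄ (f₃ x))
    (hh₀ : ∀ x, f₁ (f₀ x) = d₂ (h₀ x) + h₀ (d₀ x))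
    (hh₁ : ∀ x, f₂ (f₁ x) = d₃ (h₁ x) + h₁ (d₁ x))
    (hh₂ : ∀ x, f₃ (f₂ x) = d₄ (h₂ x) + h₂ (d₂ x))
    (inj₀ : ∀ x, d₀ x = 0 → (∃ y, d₃ y = f₂ (h₀ x) + h₁ (f₀ x)) → ∃ z, d₀ z = x)
    (surj₀ : ∀ y, d₃ y = 0 → ∃ x, d₀ x = 0 ∧ ∃ z, d₃ z = y + (f₂ (h₀ x) + h₁ (f₀ x)))
    (inj₁ : ∀ x, d₁ x = 0 → (∃ y, d₄ y = f₃ (h₁ x) + h₂ (f₁ x)) → ∃ z, d₁ z = x)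
    {a : A₀} {b : A₁} {c : A₂} (ha : d₀ a = 0) (hab : f₀ a + d₁ b = 0)
    (hc : d₂ c = h₀ a + f₁ b) :
    ∃ a' b', d₀ a' = a ∧ f₀ a' + d₁ b' = b := by
  obtain ⟨a', rfl⟩ := inj₀ a ha ⟨f₂ c + h₁ b, by
    have e₁ := congrArg f₂ hc
    have e₂ := congrArg h₁ hab
    simp only [map_add, map_zero] at e₁ e₂ ⊢
    linear_combination (norm := (match_scalars <;> decide)) (1 : F2) • (e₁ + e₂ + hf₂ c + hh₁ b)⟩
  obtain ⟨b', hb'⟩ : ∃ b', b' = b + f₀ a' := ⟨_, rfl⟩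
  obtain ⟨c', hc'⟩ : ∃ c', c' = c + h₀ a' := ⟨_, rfl⟩
  have db' : d₁ b' = 0 := by
    rw [hb', map_add]
    linear_combination (norm := (match_scalars <;> decide)) (1 : F2) • (hab + hf₀ a')
  have dc' : d₂ c' = f₁ b' := by
    simp only [hb', hc', map_add]
    linear_combination (norm := (match_scalars <;> decide)) (1 : F2) • (hc + hh₀ a')
  have ffb := hh₁ b'
  have ffc := hh₂ c'
  rw [db', map_zero, add_zero] at ffb
  rw [dc'] at ffc
  obtain ⟨w, hw, t, ht⟩ := surj₀ (f₂ c' + h₁ b') (by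
    have e₁ := hf₂ c'
    rw [dc'] at e₁
    rw [map_add]
    linear_combination (norm := (match_scalars <;> decide)) (1 : F2) • (e₁ + ffb))
  obtain ⟨s, hs⟩ := inj₁ (b' + f₀ w) (by
      have e₁ := hf₀ w
      rw [hw, map_zero] at e₁
      rw [map_add, db', ← e₁, add_zero])
    ⟨f₃ t + h₂ c' + h₂ (h₀ w), by
      have e₁ := congrArg f₃ ht
      have e₂ := psi_comp_eq (h₁ := h₁) hh₀ hh₂ hw
      simp only [map_add] at e₁ e₂ ⊢
      linear_combination (norm := (match_scalars <;> decide)) (1 : F2) • (e₁ + e₂ + ffc + hf₃ t)⟩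
  refine ⟨a' + w, s, by rw [map_add, hw, add_zero], ?_⟩
  rw [hs, hb', map_add]
  linear_combination (norm := (match_scalars <;> decide))
    (1 : F2) • ZModModule.add_self (f₀ a' + f₀ w)

/-- Every cycle of `A₂` is homologous to the image `h₀ a + f₁ b` of a cycle `(a, b)` of the cone
of `f₀`. -/
theorem exists_cone_cycle_of_cycle
    (hf₀ : ∀ x, f₀ (d₀ x) = d₁ (f₀ x)) (hf₁ : ∀ x, f₁ (d₁ x) = d₂ (f₁ x))
    (hf₂ : ∀ x, f₂ (d₂ x) = d₃ (f₂ x))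
    (hf₃ : ∀ x, f₃ (d₃ x) = d₄ (f₃ x)) (hf₄ : ∀ x, f₄ (d₄ x) = d₅ (f₄ x))
    (hψ₁ : ∀ x, f₃ (h₁ (d₁ x)) + h₂ (f₁ (d₁ x)) = d₄ (f₃ (h₁ x) + h₂ (f₁ x)))
    (hh₀ : ∀ x, f₁ (f₀ x) = d₂ (h₀ x) + h₀ (d₀ x))
    (hh₁ : ∀ x, f₂ (f₁ x) = d₃ (h₁ x) + h₁ (d₁ x))
    (hh₂ : ∀ x, f₃ (f₂ x) = d₄ (h₂ x) + h₂ (d₂ x))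
    (hh₃ : ∀ x, f₄ (f₃ x) = d₅ (h₃ x) + h₃ (d₃ x))
    (surj₀ : ∀ y, d₃ y = 0 → ∃ x, d₀ x = 0 ∧ ∃ z, d₃ z = y + (f₂ (h₀ x) + h₁ (f₀ x)))
    (inj₁ : ∀ x, d₁ x = 0 → (∃ y, d₄ y = f₃ (h₁ x) + h₂ (f₁ x)) → ∃ z, d₁ z = x)
    (surj₁ : ∀ y, d₄ y = 0 → ∃ x, d₁ x = 0 ∧ ∃ z, d₄ z = y + (f₃ (h₁ x) + h₂ (f₁ x)))
    (inj₂ : ∀ x, d₂ x = 0 → (∃ y, d₅ y = f₄ (h₂ x) + h₃ (f₂ x)) → ∃ z, d₂ z = x)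
    {y : A₂} (hy : d₂ y = 0) :
    ∃ a b, d₀ a = 0 ∧ f₀ a + d₁ b = 0 ∧ ∃ c, d₂ c = y + (h₀ a + f₁ b) := by
  have ffy := hh₂ y
  rw [hy, map_zero, add_zero] at ffy
  obtain ⟨a, ha, t, ht⟩ := surj₀ (f₂ y) (by rw [← hf₂, hy, map_zero])
  have ffa := hh₀ a
  have dfa := hf₀ a
  rw [ha, map_zero] at ffa dfa
  have psi_fa : d₄ (f₃ t + h₂ y + h₂ (h₀ a)) = f₃ (h₁ (f₀ a)) + h₂ (f₁ (f₀ a)) := by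
    have e₁ := congrArg f₃ ht
    have e₂ := psi_comp_eq (h₁ := h₁) hh₀ hh₂ ha
    simp only [map_add] at e₁ e₂ ⊢
    linear_combination (norm := (match_scalars <;> decide)) (1 : F2) • (e₁ + e₂ + ffy + hf₃ t)
  obtain ⟨b₀, hb₀⟩ := inj₁ (f₀ a) dfa.symm ⟨_, psi_fa⟩
  obtain ⟨b₁, hb₁, r, hr⟩ :=
    surj₁ (f₃ t + h₂ y + h₂ (h₀ a) + (f₃ (h₁ b₀) + h₂ (f₁ b₀))) (by
      rw [map_add, psi_fa, ← hψ₁, hb₀]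
      exact ZModModule.add_self _)
  obtain ⟨b, hb⟩ : ∃ b, b = b₀ + b₁ := ⟨_, rfl⟩
  have db : d₁ b = f₀ a := by rw [hb, map_add, hb₀, hb₁, add_zero]
  have ffb := hh₁ b
  have dfb := hf₁ b
  rw [db] at ffb dfb
  refine ⟨a, b, ha, by rw [db]; exact ZModModule.add_self _, inj₂ _ ?_ ⟨f₄ r + h₃ (t + h₁ b), ?_⟩⟩
  · simp only [map_add]
    linear_combination (norm := (match_scalars <;> decide)) (1 : F2) • (hy + ffa + dfb)
  · have e₁ : f₂ (y + (h₀ a + f₁ b)) = d₃ (t + h₁ b) := by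
      simp only [map_add]
      linear_combination (norm := (match_scalars <;> decide)) (1 : F2) • (ht + ffb)
    have e₂ : h₂ (y + (h₀ a + f₁ b)) = d₄ r + f₃ (t + h₁ b) := by
      simp only [hb, map_add] at hr ⊢
      linear_combination (norm := (match_scalars <;> decide)) (1 : F2) • hr
    rw [e₁, e₂, map_add d₅, map_add f₄]
    linear_combination (norm := (match_scalars <;> decide)) (1 : F2) • (hf₄ r + hh₃ (t + h₁ b))

end TriangleDetection

/-- Let `{(A_i, ∂_i)}_{i ∈ ℤ}` be differential modules over `𝔽₂`, `f_i` chain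
maps and `H_i` null-homotopies of `f_{i+1} ∘ f_i`.  Suppose that for every `i` the chain map
`ψ_i := f_{i+2} ∘ H_i + H_{i+1} ∘ f_i : A_i → A_{i+3}` induces an isomorphism on homology.
Then for every `i` the chain map `(H_i, f_{i+1}) : M(f_i) → A_{i+2}`, `(a, b) ↦ H_i(a) +
f_{i+1}(b)`, from the mapping cone of `f_i` induces an isomorphism
`H(M(f_i)) → H(A_{i+2})`. -/
theorem stmt6
    (A : ℤ → Type*) [∀ i, AddCommGroup (A i)] [∀ i, Module F2 (A i)]
    (d : ∀ i, A i →ₗ[F2] A i)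
    (hd : ∀ i, d i ∘ₗ d i = 0)
    (f : ∀ i, A i →ₗ[F2] A (i + 1))
    (hf : ∀ i, f i ∘ₗ d i = d (i + 1) ∘ₗ f i)
    (H : ∀ i, A i →ₗ[F2] A (i + 1 + 1))
    (hH : ∀ i, f (i + 1) ∘ₗ f i = d (i + 1 + 1) ∘ₗ H i + H i ∘ₗ d i)
    (hψchain : ∀ i, (f (i + 1 + 1) ∘ₗ H i + H (i + 1) ∘ₗ f i) ∘ₗ d i
        = d (i + 1 + 1 + 1) ∘ₗ (f (i + 1 + 1) ∘ₗ H i + H (i + 1) ∘ₗ f i))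
    (hψiso : ∀ i, Function.Bijective
        (inducedMap (d i) (d (i + 1 + 1 + 1))
          (f (i + 1 + 1) ∘ₗ H i + H (i + 1) ∘ₗ f i) (hψchain i)))
    (Dcone : ∀ i, (A i × A (i + 1)) →ₗ[F2] (A i × A (i + 1)))
    (hDcone : ∀ i (a : A i) (b : A (i + 1)), Dcone i (a, b) = (d i a, f i a + d (i + 1) b))
    (G : ∀ i, (A i × A (i + 1)) →ₗ[F2] A (i + 1 + 1))
    (hG : ∀ i (a : A i) (b : A (i + 1)), G i (a, b) = H i a + f (i + 1) b)
    (hGchain : ∀ i, G i ∘ₗ Dcone i = d (i + 1 + 1) ∘ₗ G i) :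
    ∀ i, Function.Bijective (inducedMap (Dcone i) (d (i + 1 + 1)) (G i) (hGchain i)) := by
  have hf' := fun i x => LinearMap.congr_fun (hf i) x
  have hH' := fun i x => LinearMap.congr_fun (hH i) x
  have hψ' := fun i x => LinearMap.congr_fun (hψchain i) x
  have inj := fun i => (inducedMap_injective_iff (hψchain i)).1 (hψiso i).1
  have surj := fun i => (inducedMap_surjective_iff (hψchain i)).1 (hψiso i).2
  simp only [LinearMap.comp_apply, LinearMap.add_apply] at hf' hH' hψ' inj surj
  refine fun i => ⟨(inducedMap_injective_iff _).2 ?_, (inducedMap_surjective_iff _).2 ?_⟩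
  · rintro ⟨a, b⟩ hab ⟨c, hc⟩
    rw [hDcone, Prod.mk_eq_zero] at hab
    rw [hG] at hc
    obtain ⟨a', b', ha', hb'⟩ := cone_boundary_of_image_boundary (hf' i) (hf' _) (hf' _)
      (hH' i) (hH' _) (hH' _) (inj i) (surj i) (inj _) hab.1 hab.2 hc
    exact ⟨(a', b'), by rw [hDcone, ha', hb']⟩
  · intro y hy
    obtain ⟨a, b, ha, hab, c, hc⟩ := exists_cone_cycle_of_cycle (hf' i) (hf' _) (hf' _) (hf' _)
      (hf' _) (hψ' _) (hH' i) (hH' _) (hH' _) (hH' _) (surj i) (inj _) (surj _) (inj _) hy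
    exact ⟨(a, b), by rw [hDcone, ha, hab, Prod.mk_zero_zero], c, by rw [hG, hc]⟩
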